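/- arXiv:1903.00222 — 2 statements merged into one kernel-verified Lean document; each statement's English description precedes it below -/
import Mathlib

section
/- Let T = (Q, Σ, δ) be an S-automaton, let L ⊆ Q* be a finitely suffix-closed language of state sequences, let x_1, x_2, … ∈ Σ⁺ be nonempty finite words with concatenation ξ = x_1 x_2 … ∈ Σ^ω, and set ξ_i = x_1⋯x_i for i ≥ 1. If |L∘ξ_{i+1}| > |L∘ξ_i| for every i ≥ 1, then the L-orbit L∘ξ is infinite. -/
/- Common framework for automaton semigroups acting on finite and infinite words.

An S-automaton over states `Q` and alphabet `A` is given by a partial deterministic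
transition function `δ : Q → A → Option (A × Q)` (with `δ q a = some (b, p)` encoding
the transition `q –a/b→ p`). -/

namespace AutOrbit

variable {Q A : Type*}

/-- The partial action `q∘` of a single state on a finite word. -/
def stateAct (δ : Q → A → Option (A × Q)) : Q → List A → Option (List A)
  | _, [] => some []
  | q, a :: u => (δ q a).bind fun bp => (stateAct δ bp.2 u).map fun v => bp.1 :: v

/-- The partial action `𝐪∘` of a state sequence `𝐪 = q_n … q_1` (written left-to-right,
head of the list is `q_n`; the rightmost state `q_1` is applied first). -/
def seqAct (δ : Q → A → Option (A × Q)) (l : List Q) (u : List A) : Option (List A) :=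
  l.foldr (fun q acc => acc.bind (stateAct δ q)) (some u)

/-- The length-`n` prefix of an ω-word. -/
def pre (ξ : ℕ → A) (n : ℕ) : List A := List.ofFn fun i : Fin n => ξ i

/-- The `L`-orbit `L∘u` of a finite word `u`. -/
def orbit (δ : Q → A → Option (A × Q)) (L : Set (List Q)) (u : List A) : Set (List A) :=
  {v | ∃ l ∈ L, seqAct δ l u = some v}

/-- The `L`-orbit `L∘ξ` of an ω-word `ξ`: all ω-words `η` such that some `𝐪 ∈ L` is
defined on `ξ` with `𝐪∘ξ = η` (i.e. `𝐪∘` maps every prefix of `ξ` to the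
corresponding prefix of `η`). -/
def omegaOrbit (δ : Q → A → Option (A × Q)) (L : Set (List Q)) (ξ : ℕ → A) :
    Set (ℕ → A) :=
  {η | ∃ l ∈ L, ∀ n, seqAct δ l (pre ξ n) = some (pre η n)}

/-- The set of partial maps `L∘ = {𝐪∘ ∣ 𝐪 ∈ L}`. -/
def mapsOf (δ : Q → A → Option (A × Q)) (L : Set (List Q)) :
    Set (List A → Option (List A)) :=
  {f | ∃ l ∈ L, f = seqAct δ l}

/-- `L ⊆ F*` is suffix-closed over `F`: every `𝐪 ∈ L` factorizes into factors from `F`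
such that every suffix (as a word over the alphabet `F`) of the factorization is
again in `L`. -/
def SuffixClosedOver (F L : Set (List Q)) : Prop :=
  ∀ l ∈ L, ∃ fs : List (List Q),
    (∀ f ∈ fs, f ∈ F) ∧ fs.flatten = l ∧ ∀ i, (fs.drop i).flatten ∈ L

/-- `L` is finitely suffix-closed: suffix-closed over some finite nonempty `F ⊆ Q*`. -/
def FinitelySuffixClosed (L : Set (List Q)) : Prop :=
  ∃ F : Set (List Q), F.Finite ∧ F.Nonempty ∧ SuffixClosedOver F L

/-- `u` has infinite potential w.r.t. `δ` and `L`: the orbit sizes `|L∘ux|` are unbounded. -/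
def InfinitePotential (δ : Q → A → Option (A × Q)) (L : Set (List Q)) (u : List A) : Prop :=
  ∀ C : ℕ, ∃ x : List A, C < (orbit δ L (u ++ x)).ncard

/-- The `i`-th power `𝐪^i` of a state sequence. -/
def listPow (l : List Q) (i : ℕ) : List Q := (List.replicate i l).flatten

/-- `𝐪∘` has torsion: two distinct positive powers induce the same partial map. -/
def HasTorsion (δ : Q → A → Option (A × Q)) (l : List Q) : Prop :=
  ∃ i j : ℕ, 1 ≤ i ∧ 1 ≤ j ∧ i ≠ j ∧ seqAct δ (listPow l i) = seqAct δ (listPow l j)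

/-- The automaton is complete: `δ` is total. -/
def Complete (δ : Q → A → Option (A × Q)) : Prop := ∀ q a, (δ q a).isSome

/-- The automaton is invertible: for every state, the letter-to-output-letter map is a
bijection of the alphabet (each output letter is produced by exactly one input letter). -/
def Invertible (δ : Q → A → Option (A × Q)) : Prop :=
  ∀ q b, ∃! a, ∃ p, δ q a = some (b, p)

/-- A G-automaton: a complete invertible S-automaton. -/
def GAutomaton (δ : Q → A → Option (A × Q)) : Prop := Complete δ ∧ Invertible δ

/-- Reversibility: for every input letter `a` and target state `p` there is at most one
transition `q –a/b→ p`. -/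
def Reversible (δ : Q → A → Option (A × Q)) : Prop :=
  ∀ a p q₁ b₁ q₂ b₂, δ q₁ a = some (b₁, p) → δ q₂ a = some (b₂, p) → q₁ = q₂

/-- Reversibility of the inverse automaton: for every output letter `b` and target
state `p` there is at most one transition `q –a/b→ p`. -/
def InvReversible (δ : Q → A → Option (A × Q)) : Prop :=
  ∀ b p q₁ a₁ q₂ a₂, δ q₁ a₁ = some (b, p) → δ q₂ a₂ = some (b, p) → q₁ = q₂ ∧ a₁ = a₂

/-- Bi-reversibility: the automaton and its inverse automaton are both reversible. -/
def BiReversible (δ : Q → A → Option (A × Q)) : Prop := Reversible δ ∧ InvReversible δ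

/-- The dual automaton `∂T`: states are letters, letters are states; it has a transition
`a –q/p→ b` for every transition `q –a/b→ p` of `T`. -/
def dual (δ : Q → A → Option (A × Q)) : A → Q → Option (Q × A) :=
  fun a q => (δ q a).map fun bp => (bp.2, bp.1)

/-- Adjacency of states in the underlying undirected graph of the automaton. -/
def Adj (δ : Q → A → Option (A × Q)) (q p : Q) : Prop :=
  (∃ a b, δ q a = some (b, p)) ∨ (∃ a b, δ p a = some (b, q))

/-- `P` is (the state set of) a connected component of the automaton. -/
def IsComponent (δ : Q → A → Option (A × Q)) (P : Set Q) : Prop :=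
  ∃ q, P = {p | Relation.ReflTransGen (Adj δ) q p}

/-- The sub-automaton induced on `P` (with all transitions among states of `P`)
is reversible. -/
def SubReversible (δ : Q → A → Option (A × Q)) (P : Set Q) : Prop :=
  ∀ a : A, ∀ p ∈ P, ∀ q₁ b₁ q₂ b₂, q₁ ∈ P → q₂ ∈ P →
    δ q₁ a = some (b₁, p) → δ q₂ a = some (b₂, p) → q₁ = q₂

/-- The inverse of the sub-automaton induced on `P` is reversible. -/
def SubInvReversible (δ : Q → A → Option (A × Q)) (P : Set Q) : Prop :=
  ∀ b : A, ∀ p ∈ P, ∀ q₁ a₁ q₂ a₂, q₁ ∈ P → q₂ ∈ P →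
    δ q₁ a₁ = some (b, p) → δ q₂ a₂ = some (b, p) → q₁ = q₂ ∧ a₁ = a₂

/-- The sub-automaton induced on `P` is bi-reversible. -/
def SubBiReversible (δ : Q → A → Option (A × Q)) (P : Set Q) : Prop :=
  SubReversible δ P ∧ SubInvReversible δ P

/-- For a complete automaton, the (total) action of a state on a finite word. -/
noncomputable def totAct (δ : Q → A → Option (A × Q)) (q : Q) (u : List A) : List A :=
  (stateAct δ q u).getD u

/-- The action of a state of the automaton (`Sum.inl`) or of its inverse automaton
(`Sum.inr`): for a G-automaton, `totAct δ q` is a bijection of `Σ*` and the inverse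
state `q̄` acts as its inverse bijection. -/
noncomputable def gAct (δ : Q → A → Option (A × Q)) : Q ⊕ Q → List A → List A
  | Sum.inl q => totAct δ q
  | Sum.inr q => Function.invFun (totAct δ q)

/-- Action of a sequence over `Q ⊔ Q̄` (rightmost entry applied first). -/
noncomputable def gSeqAct (δ : Q → A → Option (A × Q)) (l : List (Q ⊕ Q)) (u : List A) :
    List A :=
  l.foldr (fun s v => gAct δ s v) u

/-- The automaton group `G(T) = {𝐪∘ ∣ 𝐪 ∈ (Q ⊔ Q̄)⁺}` as a set of maps on `Σ*`. -/
def autGroup (δ : Q → A → Option (A × Q)) : Set (List A → List A) :=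
  {f | ∃ l : List (Q ⊕ Q), l ≠ [] ∧ f = gSeqAct δ l}

/-- The ultimately periodic ω-word `u (a v)^ω`. -/
def ultPer (u : List A) (a : A) (v : List A) (n : ℕ) : A :=
  if h : n < u.length then u.get ⟨n, h⟩
  else (a :: v).get ⟨(n - u.length) % (a :: v).length, Nat.mod_lt _ (by simp)⟩

/-- Run of a single state on a word, returning the output word and the final state. -/
def runState (δ : Q → A → Option (A × Q)) : Q → List A → Option (List A × Q)
  | q, [] => some ([], q)
  | q, a :: u => (δ q a).bind fun bp =>
      (runState δ bp.2 u).map fun vr => (bp.1 :: vr.1, vr.2)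

/-- Run of a state sequence `𝐪` on a word `u`, returning the output word `𝐪∘u` and the
residual state sequence `𝐪·u` (the dual action). -/
def runSeq (δ : Q → A → Option (A × Q)) : List Q → List A → Option (List A × List Q)
  | [], u => some (u, [])
  | q :: l, u => (runSeq δ l u).bind fun vr =>
      (runState δ q vr.1).map fun wp => (wp.1, wp.2 :: vr.2)

/-- Nodes of the `L`-orbital transducer over `F` of `u`: words reached from `u` along a
path of `F`-labeled edges whose reverse label (a word over `F`) lies in `L`. -/
def transNodes (δ : Q → A → Option (A × Q)) (F L : Set (List Q)) (u : List A) :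
    Set (List A) :=
  {v | ∃ fs : List (List Q), (∀ f ∈ fs, f ∈ F) ∧ fs.flatten ∈ L ∧
        ∃ r, runSeq δ fs.flatten u = some (v, r)}

/-- Edges of the `L`-orbital transducer over `F` of `u`: an edge `v –𝐩/𝐨→ w` with
`𝐩 ∈ F`, input label `𝐩`, output label `𝐨 = 𝐩·v`, lying on a path from `u` whose
reverse label is in `L`. -/
def transEdge (δ : Q → A → Option (A × Q)) (F L : Set (List Q)) (u : List A)
    (v : List A) (p o : List Q) (w : List A) : Prop :=
  p ∈ F ∧ ∃ fs : List (List Q), (∀ f ∈ fs, f ∈ F) ∧ (p :: fs).flatten ∈ L ∧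
    (∃ r, runSeq δ fs.flatten u = some (v, r)) ∧ runSeq δ p v = some (w, o)

/-- Isomorphism of the `L`-orbital transducers over `F` of `u₁` and `u₂`: a bijection of
the node sets mapping `u₁` to `u₂` and preserving labeled edges in both directions. -/
def TransducerIso (δ : Q → A → Option (A × Q)) (F L : Set (List Q)) (u₁ u₂ : List A) :
    Prop :=
  ∃ φ : List A → List A,
    Set.BijOn φ (transNodes δ F L u₁) (transNodes δ F L u₂) ∧ φ u₁ = u₂ ∧
    ∀ v ∈ transNodes δ F L u₁, ∀ w ∈ transNodes δ F L u₁, ∀ p o : List Q,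
      (transEdge δ F L u₁ v p o w ↔ transEdge δ F L u₂ (φ v) p o (φ w))


theorem stateAct_take (δ : Q → A → Option (A × Q)) (q : Q) (u v : List A)
    (h : stateAct δ q u = some v) :
    v.length = u.length ∧ ∀ m, stateAct δ q (u.take m) = some (v.take m) := by
  induction u generalizing q v with
  | nil =>
    obtain rfl : [] = v := by simpa [stateAct] using h
    simp [stateAct]
  | cons a u ih =>
    simp only [stateAct, Option.bind_eq_some_iff, Option.map_eq_some_iff] at h
    obtain ⟨bp, hbp, w, hw, rfl⟩ := h
    obtain ⟨hlen, htake⟩ := ih _ _ hw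
    refine ⟨by simp [hlen], fun m => ?_⟩
    cases m with
    | zero => simp [stateAct]
    | succ m => simp [stateAct, hbp, htake]

theorem seqAct_cons (δ : Q → A → Option (A × Q)) (q : Q) (l : List Q) (u : List A) :
    seqAct δ (q :: l) u = (seqAct δ l u).bind (stateAct δ q) := rfl

theorem seqAct_append (δ : Q → A → Option (A × Q)) (l₁ l₂ : List Q) (u : List A) :
    seqAct δ (l₁ ++ l₂) u = (seqAct δ l₂ u).bind (seqAct δ l₁) := by
  induction l₁ with
  | nil => exact (Option.bind_fun_some _).symm
  | cons q l ih =>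
    rw [List.cons_append, seqAct_cons, ih, Option.bind_assoc]
    rfl

theorem seqAct_take (δ : Q → A → Option (A × Q)) (l : List Q) (u v : List A)
    (h : seqAct δ l u = some v) :
    v.length = u.length ∧ ∀ m, seqAct δ l (u.take m) = some (v.take m) := by
  induction l generalizing v with
  | nil =>
    obtain rfl : u = v := by simpa [seqAct] using h
    simp [seqAct]
  | cons q l ih =>
    rw [seqAct_cons, Option.bind_eq_some_iff] at h
    obtain ⟨w, hw, hv⟩ := h
    obtain ⟨hlen, htake⟩ := ih _ hw
    obtain ⟨hlen', htake'⟩ := stateAct_take δ q w v hv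
    exact ⟨hlen'.trans hlen, fun m => by rw [seqAct_cons, htake, Option.bind_some, htake']⟩

theorem length_pre (ξ : ℕ → A) (n : ℕ) : (pre ξ n).length = n := by simp [pre]

theorem take_pre (ξ : ℕ → A) {m n : ℕ} (h : m ≤ n) : (pre ξ n).take m = pre ξ m := by
  apply List.ext_getElem <;> simp [pre, h]

theorem seqAct_pre_of_le (δ : Q → A → Option (A × Q)) (l : List Q) (ξ : ℕ → A) {m n : ℕ}
    (hmn : m ≤ n) {v : List A} (h : seqAct δ l (pre ξ n) = some v) :
    seqAct δ l (pre ξ m) = some (v.take m) := by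
  rw [← take_pre ξ hmn]
  exact (seqAct_take δ l _ v h).2 m

/-- A state sequence defined on all prefixes of an ω-word is defined on the ω-word. -/
theorem exists_omega_image (δ : Q → A → Option (A × Q)) (l : List Q) (ξ : ℕ → A)
    (h : ∀ n, (seqAct δ l (pre ξ n)).isSome) :
    ∃ η : ℕ → A, ∀ n, seqAct δ l (pre ξ n) = some (pre η n) := by
  choose v hv using fun n => Option.isSome_iff_exists.mp (h n)
  have hlen : ∀ n, (v n).length = n := fun n => by
    rw [(seqAct_take δ l _ _ (hv n)).1, length_pre]
  refine ⟨fun n => (v (n + 1))[n]'(by rw [hlen]; exact n.lt_succ_self), fun n => ?_⟩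
  rw [hv n]
  congr 1
  apply List.ext_getElem
  · rw [hlen, length_pre]
  · intro k hk _
    have hkn : k + 1 ≤ n := by rw [hlen] at hk; exact hk
    have hvk : v (k + 1) = (v n).take (k + 1) := by
      have := seqAct_pre_of_le δ l ξ hkn (hv n)
      rw [hv] at this
      exact Option.some.inj this
    simp [pre, hvk]

/-- If the ω-orbit is finite, every element of `L` defined on a sufficiently long prefix of `ξ`
is defined on all of `ξ`. -/
theorem exists_forall_isSome_of_finite_omegaOrbit (δ : Q → A → Option (A × Q))
    (L : Set (List Q)) (hL : FinitelySuffixClosed L) (ξ : ℕ → A)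
    (hfin : (omegaOrbit δ L ξ).Finite) :
    ∃ N, ∀ n ≥ N, ∀ l ∈ L, (seqAct δ l (pre ξ n)).isSome →
      ∃ η, ∀ m, seqAct δ l (pre ξ m) = some (pre η m) := by
  obtain ⟨F, hF, -, hclosed⟩ := hL
  have hev : ∀ᶠ n in Filter.atTop, ∀ f ∈ F, ∀ η ∈ omegaOrbit δ L ξ,
      (seqAct δ f (pre η n)).isSome → ∀ m, (seqAct δ f (pre η m)).isSome := by
    rw [Filter.eventually_all_finite hF]
    intro f _
    rw [Filter.eventually_all_finite hfin]
    intro η _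
    by_cases hall : ∀ m, (seqAct δ f (pre η m)).isSome
    · exact Filter.Eventually.of_forall fun _ _ => hall
    · obtain ⟨m, hm⟩ := not_forall.mp hall
      filter_upwards [Filter.eventually_ge_atTop m] with n hn hsome
      obtain ⟨v, hv⟩ := Option.isSome_iff_exists.mp hsome
      exact absurd (by rw [seqAct_pre_of_le δ f η hn hv]; rfl) hm
  obtain ⟨N, hN⟩ := Filter.eventually_atTop.mp hev
  refine ⟨N, fun n hn l hl => ?_⟩
  obtain ⟨fs, hfs, rfl, hsuff⟩ := hclosed l hl
  clear hl
  induction fs with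
  | nil => exact fun _ => ⟨ξ, fun _ => rfl⟩
  | cons f fs ih =>
    intro hsome
    simp only [List.flatten_cons, seqAct_append] at hsome ⊢
    have hfs' : (seqAct δ fs.flatten (pre ξ n)).isSome :=
      Option.isSome_of_isSome_bind hsome
    obtain ⟨η, hη⟩ := ih (fun g hg => hfs g (List.mem_cons_of_mem _ hg))
      (fun i => hsuff (i + 1)) hfs'
    simp only [hη, Option.bind_some] at hsome ⊢
    exact exists_omega_image δ f η
      (hN n hn f (hfs f List.mem_cons_self) η ⟨_, hsuff 1, hη⟩ hsome)

theorem le_length_flatten_ofFn (x : ℕ → List A) (hx : ∀ i, x i ≠ []) (i : ℕ) :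
    i ≤ (List.ofFn fun k : Fin i => x k).flatten.length := by
  induction i with
  | zero => exact Nat.zero_le _
  | succ i ih =>
    have := List.length_pos_iff.mpr (hx i)
    rw [List.ofFn_succ', List.concat_eq_append, List.flatten_append, List.length_append]
    simp only [Fin.val_castSucc, Fin.val_last, List.flatten_cons, List.flatten_nil,
      List.append_nil]
    omega

/-- If `ξ = x₀ x₁ x₂ ⋯` is a concatenation of nonempty finite words and
the sizes of the `L`-orbits of the finite prefixes `ξ_i = x₀ ⋯ x_{i-1}` strictly increase,
then the `L`-orbit of `ξ` is infinite. -/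
theorem omegaOrbit_infinite_of_increasing_orbits {Q A : Type*} [Fintype Q] [Fintype A]
    [Nonempty A] (δ : Q → A → Option (A × Q)) (L : Set (List Q))
    (hL : FinitelySuffixClosed L)
    (x : ℕ → List A) (hx : ∀ i, x i ≠ []) (ξ : ℕ → A)
    (hpre : ∀ i : ℕ, (List.ofFn fun k : Fin i => x k).flatten =
      pre ξ ((List.ofFn fun k : Fin i => x k).flatten).length)
    (hgrow : ∀ i : ℕ, 1 ≤ i →
      (orbit δ L ((List.ofFn fun k : Fin i => x k).flatten)).ncard <
        (orbit δ L ((List.ofFn fun k : Fin (i + 1) => x k).flatten)).ncard) :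
    (omegaOrbit δ L ξ).Infinite := by
  intro hfin
  obtain ⟨N, hN⟩ := exists_forall_isSome_of_finite_omegaOrbit δ L hL ξ hfin
  set w : ℕ → List A := fun i => (List.ofFn fun k : Fin i => x k).flatten
  have hle : ∀ i ≥ N, (orbit δ L (w i)).ncard ≤ (omegaOrbit δ L ξ).ncard := by
    intro i hi
    have hsub : orbit δ L (w i) ⊆ (fun η => pre η (w i).length) '' omegaOrbit δ L ξ := by
      rintro v ⟨l, hl, hv⟩
      rw [show w i = pre ξ (w i).length from hpre i] at hv
      obtain ⟨η, hη⟩ := hN _ (hi.trans (le_length_flatten_ofFn x hx i)) l hl (by rw [hv]; rfl)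
      refine ⟨η, ⟨l, hl, hη⟩, ?_⟩
      rw [hη] at hv
      exact Option.some.inj hv
    exact (Set.ncard_le_ncard hsub (hfin.image _)).trans (Set.ncard_image_le hfin)
  have hge : ∀ i, i ≤ (orbit δ L (w (i + 1))).ncard := by
    intro i
    induction i with
    | zero => exact Nat.zero_le _
    | succ i ih => exact ih.trans_lt (hgrow (i + 1) (Nat.le_add_left 1 i))
  have h₁ := hge (N + (omegaOrbit δ L ξ).ncard + 1)
  have h₂ := hle (N + (omegaOrbit δ L ξ).ncard + 1 + 1) (by omega)
  omega

end AutOrbit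
end

section
/- Let T = (Q, Σ, δ) be an S-automaton, let L ⊆ Q* be a finitely suffix-closed language of state sequences, and let u ∈ Σ* be a finite word with infinite potential with respect to T and L. Then there is some x ∈ Σ* such that ux still has infinite potential and has a strictly larger L-orbit: |L∘ux| > |L∘u|. -/
/- Common framework for automaton semigroups acting on finite and infinite words.

An S-automaton over states `Q` and alphabet `A` is given by a partial deterministic
transition function `δ : Q → A → Option (A × Q)` (with `δ q a = some (b, p)` encoding
the transition `q –a/b→ p`). -/

namespace AutOrbit

variable {Q A : Type*}

theorem runState_length (δ : Q → A → Option (A × Q)) {q p : Q} {u v : List A}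
    (h : runState δ q u = some (v, p)) : v.length = u.length := by
  induction u generalizing q v with
  | nil => simp_all [runState]
  | cons a u ih =>
    simp only [runState, Option.bind_eq_some_iff, Option.map_eq_some_iff] at h
    obtain ⟨⟨b, q'⟩, -, ⟨w, r⟩, hw, h⟩ := h
    obtain ⟨rfl, rfl⟩ := Prod.mk.inj h
    simp [ih hw]

theorem runSeq_length (δ : Q → A → Option (A × Q)) {l o : List Q} {u v : List A}
    (h : runSeq δ l u = some (v, o)) : v.length = u.length ∧ o.length = l.length := by
  induction l generalizing v o with
  | nil => simp_all [runSeq]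
  | cons q l ih =>
    simp only [runSeq, Option.bind_eq_some_iff, Option.map_eq_some_iff] at h
    obtain ⟨⟨w, r⟩, hw, ⟨w', p⟩, hp, h⟩ := h
    obtain ⟨rfl, rfl⟩ := Prod.mk.inj h
    simp [runState_length δ hp, ih hw]

theorem stateAct_append (δ : Q → A → Option (A × Q)) (q : Q) (u y : List A) :
    stateAct δ q (u ++ y) =
      (runState δ q u).bind fun wp => (stateAct δ wp.2 y).map (wp.1 ++ ·) := by
  induction u generalizing q with
  | nil => simp [runState]
  | cons a u ih =>
    cases h : δ q a with
    | none => simp [stateAct, runState, h]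
    | some bp =>
      simp only [List.cons_append, stateAct, runState, h, Option.bind_some, ih]
      cases runState δ bp.2 u <;> simp [Function.comp_def]

theorem seqAct_append_s4 (δ : Q → A → Option (A × Q)) (l : List Q) (u y : List A) :
    seqAct δ l (u ++ y) =
      (runSeq δ l u).bind fun wo => (seqAct δ wo.2 y).map (wo.1 ++ ·) := by
  induction l with
  | nil => simp [seqAct, runSeq]
  | cons q l ih =>
    have hcons (q : Q) (l : List Q) (v : List A) :
        seqAct δ (q :: l) v = (seqAct δ l v).bind (stateAct δ q) := rfl
    rw [hcons, ih]
    cases h : runSeq δ l u with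
    | none => simp [runSeq, h]
    | some wo =>
      cases h' : seqAct δ wo.2 y with
      | none => cases h'' : runState δ q wo.1 <;> simp [runSeq, h, hcons, h', h'']
      | some z =>
        cases h'' : runState δ q wo.1 <;> simp [runSeq, h, hcons, h', h'', stateAct_append]

theorem seqAct_nil (δ : Q → A → Option (A × Q)) (l : List Q) :
    seqAct δ l [] = some [] := by
  induction l with
  | nil => rfl
  | cons q l ih =>
    change (seqAct δ l []).bind (stateAct δ q) = _
    simp [ih, stateAct]

theorem seqAct_eq_map_runSeq (δ : Q → A → Option (A × Q)) (l : List Q) (u : List A) :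
    seqAct δ l u = (runSeq δ l u).map Prod.fst := by
  have h := seqAct_append_s4 δ l u []
  cases h' : runSeq δ l u <;> simpa [h', seqAct_nil] using h

theorem runSeq_append (δ : Q → A → Option (A × Q)) (l₁ l₂ : List Q) (u : List A) :
    runSeq δ (l₁ ++ l₂) u =
      (runSeq δ l₂ u).bind fun wo => (runSeq δ l₁ wo.1).map fun r => (r.1, r.2 ++ wo.2) := by
  induction l₁ with
  | nil => simp [runSeq]
  | cons q l ih =>
    simp only [List.cons_append, runSeq, ih]
    cases runSeq δ l₂ u with
    | none => rfl
    | some wo =>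
      cases h : runSeq δ l wo.1 with
      | none => simp [h]
      | some r => cases h' : runState δ q r.1 <;> simp [h, h']

theorem mem_orbit_iff (δ : Q → A → Option (A × Q)) (L : Set (List Q)) (u v : List A) :
    v ∈ orbit δ L u ↔ ∃ l ∈ L, ∃ o, runSeq δ l u = some (v, o) := by
  simp [orbit, seqAct_eq_map_runSeq]

theorem mem_orbit_append_iff (δ : Q → A → Option (A × Q)) (L : Set (List Q))
    (u y v : List A) :
    v ∈ orbit δ L (u ++ y) ↔
      ∃ l ∈ L, ∃ w o, runSeq δ l u = some (w, o) ∧ ∃ z, seqAct δ o y = some z ∧ w ++ z = v := by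
  simp [orbit, seqAct_append_s4, Option.bind_eq_some_iff]

theorem orbit_finite [Finite A] (δ : Q → A → Option (A × Q)) (L : Set (List Q))
    (u : List A) : (orbit δ L u).Finite := by
  refine (List.finite_length_eq A u.length).subset fun v hv => ?_
  obtain ⟨l, -, o, h⟩ := (mem_orbit_iff δ L u v).1 hv
  exact (runSeq_length δ h).1

/-- In the transducer over `ι` with edge set `S`, the reverse label `fs` is read along a path
from `s` to the given node with the given output. -/
def LabeledPath {ι : Type*} (S : Set (ι × List Q × List Q × ι)) (s : ι) :
    List (List Q) → ι → List Q → Prop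
  | [], j, o => j = s ∧ o = []
  | p :: fs, j, o => ∃ i o₁ o₂, LabeledPath S s fs i o₁ ∧ (i, p, o₂, j) ∈ S ∧ o = o₂ ++ o₁

/-- The orbit computed by an abstract transducer with initial node `s` and edge set `S`. -/
def codeOrbit {ι : Type*} (δ : Q → A → Option (A × Q)) (L : Set (List Q))
    (s : ι) (S : Set (ι × List Q × List Q × ι)) (y : List A) : Set (ι × List A) :=
  {t | ∃ fs : List (List Q), fs.flatten ∈ L ∧
    ∃ o, LabeledPath S s fs t.1 o ∧ seqAct δ o y = some t.2}

/-- The edges between elements of the orbit of `v`, with nodes renamed by `e`. -/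
def codeEdges {ι : Type*} (δ : Q → A → Option (A × Q)) (F L : Set (List Q)) (v : List A)
    (e : List A → ι) : Set (ι × List Q × List Q × ι) :=
  {t | t.2.1 ∈ F ∧ ∃ w ∈ orbit δ L v, ∃ w' ∈ orbit δ L v,
    e w = t.1 ∧ e w' = t.2.2.2 ∧ runSeq δ t.2.1 w = some (w', t.2.2.1)}

theorem exists_runSeq_of_labeledPath {ι : Type*} (δ : Q → A → Option (A × Q))
    (F L : Set (List Q)) (v : List A) (e : List A → ι) (he : Set.InjOn e (orbit δ L v))
    (hv : v ∈ orbit δ L v) {fs : List (List Q)} {j : ι} {o : List Q}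
    (h : LabeledPath (codeEdges δ F L v e) (e v) fs j o) :
    ∃ w ∈ orbit δ L v, e w = j ∧ runSeq δ fs.flatten v = some (w, o) := by
  induction fs generalizing j o with
  | nil =>
    obtain ⟨rfl, rfl⟩ := h
    exact ⟨v, hv, rfl, rfl⟩
  | cons p fs ih =>
    obtain ⟨i, o₁, o₂, hp, ⟨-, w₁, hw₁, w₂, hw₂, h₁, h₂, hr⟩, rfl⟩ := h
    obtain ⟨w, hw, hwi, hrun⟩ := ih hp
    obtain rfl := he hw₁ hw (h₁.trans hwi.symm)
    refine ⟨w₂, hw₂, h₂, ?_⟩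
    simp only at hr
    simp [runSeq_append, hrun, hr]

theorem labeledPath_of_runSeq {ι : Type*} (δ : Q → A → Option (A × Q))
    (F L : Set (List Q)) (v : List A) (e : List A → ι) {fs : List (List Q)}
    (hF : ∀ f ∈ fs, f ∈ F) (hL : ∀ i, (fs.drop i).flatten ∈ L) {w : List A} {o : List Q}
    (h : runSeq δ fs.flatten v = some (w, o)) :
    LabeledPath (codeEdges δ F L v e) (e v) fs (e w) o := by
  induction fs generalizing w o with
  | nil =>
    simp only [List.flatten_nil, runSeq, Option.some.injEq, Prod.mk.injEq] at h
    obtain ⟨rfl, rfl⟩ := h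
    exact ⟨rfl, rfl⟩
  | cons p fs ih =>
    have hw : w ∈ orbit δ L v := (mem_orbit_iff δ L v w).2 ⟨_, hL 0, o, h⟩
    simp only [List.flatten_cons, runSeq_append, Option.bind_eq_some_iff,
      Option.map_eq_some_iff] at h
    obtain ⟨⟨w₁, o₁⟩, h₁, ⟨w₂, o₂⟩, h₂, h⟩ := h
    obtain ⟨rfl, rfl⟩ := Prod.mk.inj h
    have hw₁ : w₁ ∈ orbit δ L v := (mem_orbit_iff δ L v w₁).2 ⟨_, hL 1, o₁, h₁⟩
    exact ⟨e w₁, o₁, o₂,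
      ih (fun f hf => hF f (List.mem_cons_of_mem _ hf)) (fun i => hL (i + 1)) h₁,
      ⟨hF p List.mem_cons_self, w₁, hw₁, w₂, hw, rfl, rfl, h₂⟩, rfl⟩

theorem ncard_codeOrbit {ι : Type*} (δ : Q → A → Option (A × Q)) {F L : Set (List Q)}
    (hL : SuffixClosedOver F L) (v : List A) (e : List A → ι)
    (he : Set.InjOn e (orbit δ L v)) (y : List A) :
    (codeOrbit δ L (e v) (codeEdges δ F L v e) y).ncard = (orbit δ L (v ++ y)).ncard := by
  have hlen {w x : List A} {l o : List Q} (h : runSeq δ l v = some (w, o)) :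
      (w ++ x).take v.length = w ∧ (w ++ x).drop v.length = x := by
    simp [← (runSeq_length δ h).1]
  have himage : codeOrbit δ L (e v) (codeEdges δ F L v e) y =
      (fun x => (e (x.take v.length), x.drop v.length)) '' orbit δ L (v ++ y) := by
    ext ⟨j, z⟩
    constructor
    · rintro ⟨fs, hfs, o, hp, hz⟩
      have hv : v ∈ orbit δ L v := by
        obtain ⟨gs, -, -, hgs⟩ := hL _ hfs
        exact (mem_orbit_iff δ L v v).2 ⟨[], by simpa using hgs gs.length, [], rfl⟩
      obtain ⟨w, hw, rfl, hrun⟩ := exists_runSeq_of_labeledPath δ F L v e he hv hp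
      refine ⟨w ++ z, (mem_orbit_append_iff δ L v y _).2 ⟨_, hfs, w, o, hrun, z, hz, rfl⟩, ?_⟩
      simp only [hlen hrun]
    · rintro ⟨x, hx, hxz⟩
      obtain ⟨l, hl, w, o, hrun, z', hz', rfl⟩ := (mem_orbit_append_iff δ L v y _).1 hx
      simp only [hlen hrun, Prod.mk.injEq] at hxz
      obtain ⟨rfl, rfl⟩ := hxz
      obtain ⟨fs, hF, rfl, hfs⟩ := hL l hl
      exact ⟨fs, hl, o, labeledPath_of_runSeq δ F L v e hF hfs hrun, hz'⟩
  rw [himage]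
  refine Set.InjOn.ncard_image fun x hx x' hx' hxx => ?_
  obtain ⟨l, hl, w, o, hrun, z, hz, rfl⟩ := (mem_orbit_append_iff δ L v y _).1 hx
  obtain ⟨l', hl', w', o', hrun', z', hz', rfl⟩ := (mem_orbit_append_iff δ L v y _).1 hx'
  simp only [hlen hrun, hlen hrun', Prod.mk.injEq] at hxx
  rw [he ((mem_orbit_iff δ L v w).2 ⟨l, hl, o, hrun⟩)
    ((mem_orbit_iff δ L v w').2 ⟨l', hl', o', hrun'⟩) hxx.1, hxx.2]

theorem exists_potential_bound [Finite Q] [Finite A] (δ : Q → A → Option (A × Q))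
    {L : Set (List Q)} (hL : FinitelySuffixClosed L) (m : ℕ) :
    ∃ B : ℕ, ∀ (v : List A) (a : A), (orbit δ L v).ncard ≤ m →
      ¬ InfinitePotential δ L (v ++ [a]) → ∀ y, (orbit δ L (v ++ a :: y)).ncard ≤ B := by
  obtain ⟨F, hF, -, hL⟩ := hL
  let ι := Fin (m + 1)
  let T : Set (ι × List Q × List Q × ι) := {t | t.2.1 ∈ F ∧ t.2.2.1.length = t.2.1.length}
  have hT : T.Finite := by
    have hout : (⋃ p ∈ F, {o : List Q | o.length = p.length}).Finite :=
      hF.biUnion fun p _ => List.finite_length_eq Q p.length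
    refine (Set.finite_univ.prod (hF.prod (hout.prod Set.finite_univ))).subset ?_
    rintro ⟨i, p, o, j⟩ ⟨hp, ho⟩
    exact ⟨trivial, hp, Set.mem_biUnion hp ho, trivial⟩
  have hbound : ∀ c : (ι × Set (ι × List Q × List Q × ι)) × A, ∃ b : ℕ,
      (∃ b' : ℕ, ∀ y, (codeOrbit δ L c.1.1 c.1.2 (c.2 :: y)).ncard ≤ b') →
        ∀ y, (codeOrbit δ L c.1.1 c.1.2 (c.2 :: y)).ncard ≤ b := by
    intro c
    by_cases h : ∃ b' : ℕ, ∀ y, (codeOrbit δ L c.1.1 c.1.2 (c.2 :: y)).ncard ≤ b'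
    · exact h.imp fun _ hb _ => hb
    · exact ⟨0, fun h' => absurd h' h⟩
  choose b hb using hbound
  have hfin : (((Set.univ : Set ι) ×ˢ T.powerset) ×ˢ (Set.univ : Set A)).Finite :=
    (Set.finite_univ.prod hT.finite_subsets).prod Set.finite_univ
  obtain ⟨B, hB⟩ := (hfin.image b).bddAbove
  refine ⟨B, fun v a hv hpot y => ?_⟩
  obtain ⟨e, -, he⟩ : ∃ e : List A → ι,
      Set.MapsTo e (orbit δ L v) Set.univ ∧ Set.InjOn e (orbit δ L v) := by
    have hle : (orbit δ L v).encard ≤ (Set.univ : Set ι).encard := by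
      rw [← (orbit_finite δ L v).cast_ncard_eq, ← Set.finite_univ.cast_ncard_eq,
        Set.ncard_univ, Nat.card_fin]
      exact_mod_cast hv.trans m.le_succ
    exact (orbit_finite δ L v).exists_injOn_of_encard_le hle
  have hcard := ncard_codeOrbit δ hL v e he
  have hpot' : ∃ b' : ℕ, ∀ y, (orbit δ L (v ++ a :: y)).ncard ≤ b' := by
    simpa [InfinitePotential] using hpot
  have hmem : ((e v, codeEdges δ F L v e), a) ∈
      (((Set.univ : Set ι) ×ˢ T.powerset) ×ˢ (Set.univ : Set A)) := by
    refine ⟨⟨trivial, ?_⟩, trivial⟩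
    rintro ⟨i, p, o, j⟩ ⟨hp, w, -, w', -, -, -, hr⟩
    exact ⟨hp, (runSeq_length δ hr).2⟩
  have hle := hb ((e v, codeEdges δ F L v e), a) (by simpa only [hcard] using hpot') y
  rw [hcard] at hle
  exact hle.trans (hB ⟨_, hmem, rfl⟩)

theorem exists_append_cons_of_not {α : Type*} {P : List α → Prop} (h : P []) {y : List α}
    (hy : ¬ P y) : ∃ x a z, y = x ++ a :: z ∧ P x ∧ ¬ P (x ++ [a]) := by
  induction y using List.reverseRecOn with
  | nil => exact absurd h hy
  | append_singleton y a ih =>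
    by_cases hP : P y
    · exact ⟨y, a, [], rfl, hP, hy⟩
    · obtain ⟨x, b, z, rfl, hx, hxb⟩ := ih hP
      exact ⟨x, b, z ++ [a], by simp, hx, hxb⟩

/-- A word `u` with infinite potential (w.r.t. a finitely suffix-closed
`L`) can be extended to `ux` which still has infinite potential and a strictly larger
`L`-orbit. -/
theorem extend_infinite_potential {Q A : Type*} [Fintype Q] [Fintype A] [Nonempty A]
    (δ : Q → A → Option (A × Q)) (L : Set (List Q)) (hL : FinitelySuffixClosed L)
    (u : List A) (hu : InfinitePotential δ L u) :
    ∃ x : List A, InfinitePotential δ L (u ++ x) ∧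
      (orbit δ L u).ncard < (orbit δ L (u ++ x)).ncard := by
  by_contra! hcon
  obtain ⟨B, hB⟩ := exists_potential_bound δ hL (orbit δ L u).ncard
  obtain ⟨y, hy⟩ := hu (max B (orbit δ L u).ncard)
  have hyP : ¬ InfinitePotential δ L (u ++ y) := fun h =>
    absurd (hcon y h) ((le_max_right _ _).trans_lt hy).not_ge
  obtain ⟨x, a, z, rfl, hx, hxa⟩ := exists_append_cons_of_not
    (P := fun y => InfinitePotential δ L (u ++ y)) (by simpa using hu) hyP
  have h := hB (u ++ x) a (hcon x hx) (by simpa using hxa) z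
  rw [List.append_assoc] at h
  exact absurd h ((le_max_left _ _).trans_lt hy).not_ge

end AutOrbit
end
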